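/- Let G be a finite simple connected graph which is not a cycle and has at least two edges. Then I(G) = ⋂_H I(H), where the intersection is taken over all proper connected subgraphs H of G, and each I(H) is viewed as an ideal of S. -/

import Mathlib

open MvPolynomial

/-- Indicator: does the edge `e` cross the partition `A | Aᶜ`? -/
def crossBool {V : Type} [DecidableEq V] (A : Finset V) : Sym2 V → Bool :=
  Sym2.lift ⟨fun i j => xor (decide (i ∈ A)) (decide (j ∈ A)), fun i j => Bool.xor_comm _ _⟩

/-- The cut monomial `u_{A|B}` (with `B = Aᶜ`), formed from the edges in `E'`,
viewed in the polynomial ring `S` on variables `s_e = X (e, true)`, `t_e = X (e, false)`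
indexed by the edges of the ambient graph `G`. -/
noncomputable def cutGen (k : Type) [Field k] {V : Type} [DecidableEq V]
    (G : SimpleGraph V) (E' : Finset (Sym2 V)) (hE' : ↑E' ⊆ G.edgeSet) (A : Finset V) :
    MvPolynomial (↥G.edgeSet × Bool) k :=
  ∏ e ∈ E'.attach, X (⟨⟨e.1, hE' e.2⟩, crossBool A e.1⟩ : ↥G.edgeSet × Bool)

/-- The monomial cut ideal of the subgraph of `G` with edge set `E'`,
viewed as an ideal of the polynomial ring associated to `G`. -/
noncomputable def cutIdealOn (k : Type) [Field k] {V : Type} [DecidableEq V]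
    (G : SimpleGraph V) (E' : Finset (Sym2 V)) (hE' : ↑E' ⊆ G.edgeSet) :
    Ideal (MvPolynomial (↥G.edgeSet × Bool) k) :=
  Ideal.span (Set.range (cutGen k G E' hE'))

/-- The monomial cut ideal `I(G)` of the graph `G`. -/
noncomputable def cutIdeal (k : Type) [Field k] {V : Type} [DecidableEq V]
    (G : SimpleGraph V) [Fintype G.edgeSet] :
    Ideal (MvPolynomial (↥G.edgeSet × Bool) k) :=
  cutIdealOn k G G.edgeSet.toFinset (by simp)

/-- The monomial cut ideal of a subgraph `H` of `G`, viewed as an ideal of the polynomial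
ring associated to `G`: it is generated by the cut monomials of the partitions, formed
using only the variables attached to the edges of `H`. -/
noncomputable def subgraphCutIdeal (k : Type) [Field k] {V : Type} [DecidableEq V]
    (G : SimpleGraph V) [Fintype G.edgeSet] (H : G.Subgraph) :
    Ideal (MvPolynomial (↥G.edgeSet × Bool) k) :=
  cutIdealOn k G ((Set.Finite.subset G.edgeSet.toFinite H.edgeSet_subset).toFinset)
    (by rw [Set.Finite.coe_toFinset]; exact H.edgeSet_subset)

theorem cycleGraph_adj_val {n : ℕ} (hn : 3 ≤ n) (i j : Fin n) :
    (SimpleGraph.cycleGraph n).Adj i j ↔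
      ((j.val = (if i.val + 1 = n then 0 else i.val + 1)) ∨
       (i.val = (if j.val + 1 = n then 0 else j.val + 1))) := by
  have key : ∀ a b : Fin n, (a - b).val = 1 ↔
      a.val = (if b.val + 1 = n then 0 else b.val + 1) := by
    intro a b
    have ha := a.2
    have hb := b.2
    rw [Fin.sub_def]
    simp only
    rcases lt_or_ge (n - b.val + a.val) n with h | h
    · rw [Nat.mod_eq_of_lt h]; split_ifs <;> omega
    · rw [Nat.mod_eq_sub_mod h, Nat.mod_eq_of_lt (by omega)]; split_ifs <;> omega
  rw [SimpleGraph.cycleGraph_adj', key, key, or_comm]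

theorem iso_cycleGraph_of_isCycle {V : Type} (G : SimpleGraph V) {u : V} (q : G.Walk u u)
    (hq : q.IsCycle) (htop : q.toSubgraph = ⊤) :
    Nonempty (G ≃g SimpleGraph.cycleGraph q.length) := by
  have h3 := hq.three_le_length
  let f : Fin q.length → V := fun i => q.getVert i.val
  have hnext : ∀ m, m < q.length → q.getVert (m + 1) =
      q.getVert (if m + 1 = q.length then 0 else m + 1) := by
    intro m hm
    split_ifs with h
    · rw [h]; simp
    · rfl
  have hinj : ∀ a b, a < q.length → b < q.length → q.getVert a = q.getVert b → a = b := by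
    intro a b ha hb h
    exact hq.getVert_injOn' (by simp only [Set.mem_ofPred_eq]; omega)
      (by simp only [Set.mem_ofPred_eq]; omega) h
  have hbij : Function.Bijective f := by
    constructor
    · intro i j hij
      exact Fin.ext (hinj _ _ i.2 j.2 hij)
    · intro w
      have hw : w ∈ q.toSubgraph.verts := by rw [htop]; trivial
      rw [SimpleGraph.Walk.mem_verts_toSubgraph,
        SimpleGraph.Walk.mem_support_iff_exists_getVert] at hw
      obtain ⟨m, rfl, hm⟩ := hw
      rcases Nat.lt_or_ge m q.length with h | h
      · exact ⟨⟨m, h⟩, rfl⟩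
      · refine ⟨⟨0, by omega⟩, ?_⟩
        have : m = q.length := by omega
        subst this
        simp [f]
  refine ⟨(SimpleGraph.Iso.symm ⟨Equiv.ofBijective f hbij, ?_⟩)⟩
  intro i j
  rw [cycleGraph_adj_val h3]
  have hadj : G.Adj (f i) (f j) ↔ q.toSubgraph.Adj (f i) (f j) := by rw [htop]; simp
  change G.Adj (f i) (f j) ↔ _
  rw [hadj, SimpleGraph.Walk.toSubgraph_adj_iff]
  have hi := i.2
  have hj := j.2
  constructor
  · rintro ⟨m, hm, hml⟩
    rw [hnext m hml, Sym2.eq_iff] at hm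
    have hlt : (if m + 1 = q.length then 0 else m + 1) < q.length := by split_ifs <;> omega
    rcases hm with ⟨h1, h2⟩ | ⟨h1, h2⟩
    · left
      rw [← hinj _ _ hml hi h1, ← hinj _ _ hlt hj h2]
    · right
      rw [← hinj _ _ hml hj h1, ← hinj _ _ hlt hi h2]
  · rintro (h | h)
    · refine ⟨i.val, ?_, hi⟩
      rw [hnext _ hi, ← h]
    · refine ⟨j.val, ?_, hj⟩
      rw [hnext _ hj, ← h, Sym2.eq_swap]

theorem crossBool_mk {V : Type} [DecidableEq V] (A : Finset V) (i j : V) :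
    crossBool A s(i, j) = xor (decide (i ∈ A)) (decide (j ∈ A)) := rfl

/-- Two colorings inducing the same crossing values along a walk differ by a constant. -/
theorem cross_agree_walk {V : Type} [DecidableEq V] {K : SimpleGraph V} (A B : Finset V)
    {u v : V} (p : K.Walk u v)
    (h : ∀ e ∈ p.edges, crossBool A e = crossBool B e) :
    crossBool A s(u, v) = crossBool B s(u, v) := by
  induction p with
  | nil => simp [crossBool_mk]
  | cons hadj p ih =>
    have h1 := h _ (by simp; left; rfl)
    have h2 := ih (fun e he => h e (by simp [he]))
    simp only [crossBool_mk] at *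
    grind

theorem comb_core {V : Type} [Fintype V] [DecidableEq V] (G : SimpleGraph V)
    (hnotcycle : ¬ ∃ n : ℕ, 3 ≤ n ∧ Nonempty (G ≃g SimpleGraph.cycleGraph n))
    (P : Sym2 V → Bool → Prop)
    (hne : ∀ e ∈ G.edgeSet, ∃ b, P e b)
    (hH : ∀ H : G.Subgraph, H ≠ ⊤ → H.Connected →
      ∃ A : Finset V, ∀ e ∈ H.edgeSet, P e (crossBool A e)) :
    ∃ A : Finset V, ∀ e ∈ G.edgeSet, P e (crossBool A e) := by
  classical
  let 𝒦 : Set (SimpleGraph V) := {K | K ≤ G ∧ (∀ e ∈ K.edgeSet, ∃ b, ¬ P e b) ∧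
    ∃ A : Finset V, ∀ e ∈ K.edgeSet, P e (crossBool A e)}
  have hfin : 𝒦.Finite := Set.toFinite _
  have hnon : 𝒦.Nonempty := ⟨⊥, bot_le, by simp, ∅, by simp⟩
  obtain ⟨K, hKmax⟩ := hfin.exists_maximal hnon
  obtain ⟨hKG, hKc, A, hA⟩ := hKmax.prop
  by_contra hbad
  push Not at hbad
  obtain ⟨e, heG, heA⟩ := hbad A
  induction e using Sym2.ind with
  | _ u v =>
  have huv : G.Adj u v := heG
  have uniq : ∀ e, (∃ b, ¬ P e b) → ∀ b b', P e b → P e b' → b = b' := by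
    rintro e ⟨c, hc⟩ b b' h1 h2
    cases b <;> cases b' <;> cases c <;> simp_all
  by_cases hr : K.Reachable v u
  · obtain ⟨p, hp⟩ := hr.exists_isPath
    let p' := p.mapLe hKG
    have hp' : p'.IsPath := hp.mapLe hKG
    have hedges : p'.edges = p.edges := by simp [p']
    have hnot : s(u, v) ∉ p'.edges := by
      rw [hedges]
      intro hmem
      exact heA (hA _ (p.edges_subset_edgeSet hmem))
    let q : G.Walk u u := SimpleGraph.Walk.cons huv p'
    have hq : q.IsCycle := (SimpleGraph.Walk.cons_isCycle_iff _ _).2 ⟨hp', hnot⟩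
    by_cases htop : q.toSubgraph = ⊤
    · exact hnotcycle ⟨_, hq.three_le_length, iso_cycleGraph_of_isCycle G q hq htop⟩
    · obtain ⟨B, hB⟩ := hH _ htop q.toSubgraph_connected
      have hB' : ∀ e ∈ q.edges, P e (crossBool B e) := fun e he =>
        hB e ((SimpleGraph.Walk.mem_edges_toSubgraph q).2 he)
      have := cross_agree_walk A B p (fun e he => uniq e
        (hKc e (p.edges_subset_edgeSet he)) _ _ (hA e (p.edges_subset_edgeSet he))
        (hB' e (by simp [q, hedges, he])))
      rw [Sym2.eq_swap] at this
      rw [this] at heA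
      exact heA (hB' _ (by simp [q]))
  · have hle : K ⊔ SimpleGraph.edge u v ≤ K := by
      apply hKmax.le_of_ge _ le_sup_left
      have hed : ∀ e ∈ (K ⊔ SimpleGraph.edge u v).edgeSet, e ∈ K.edgeSet ∨ e = s(u, v) := by
        intro e he
        rw [SimpleGraph.edgeSet_sup] at he
        rcases he with he | he
        · exact Or.inl he
        · right
          rw [SimpleGraph.edgeSet_edge_of_ne huv.ne] at he
          exact he
      refine ⟨sup_le hKG (by rw [SimpleGraph.edge_le_iff]; exact Or.inr huv), ?_, ?_⟩
      · intro e he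
        rcases hed e he with h | rfl
        · exact hKc e h
        · exact ⟨_, heA⟩
      · refine ⟨Finset.univ.filter fun w => (xor (decide (w ∈ A)) (decide (K.Reachable v w))) = true,
          ?_⟩
        intro e he
        rcases hed e he with h | rfl
        · have := hA e h
          convert this using 1
          induction e using Sym2.ind with
          | _ a b =>
          have hab : K.Adj a b := h
          have : K.Reachable v a ↔ K.Reachable v b :=
            ⟨fun h => h.trans hab.reachable, fun h => h.trans hab.symm.reachable⟩
          simp only [crossBool_mk, Finset.mem_filter, Finset.mem_univ, true_and, this]
          generalize decide (K.Reachable v b) = x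
          generalize decide (a ∈ A) = y
          generalize decide (b ∈ A) = z
          revert x y z; decide
        · obtain ⟨b, hb⟩ := hne _ heG
          convert hb using 1
          have hb2 : b ≠ crossBool A s(u, v) := by rintro rfl; exact heA hb
          have hvv : K.Reachable v v := SimpleGraph.Reachable.refl v
          simp only [crossBool_mk, Finset.mem_filter, Finset.mem_univ, true_and, hr, hvv] at hb2 ⊢
          generalize decide (u ∈ A) = y at *
          generalize decide (v ∈ A) = z at *
          clear hb
          revert y z b; decide
    have : K.Adj u v := hle (Or.inr (by simp [SimpleGraph.edge_adj, huv.ne]))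
    exact hr this.symm.reachable

theorem mem_cutIdealOn {k : Type} [Field k] {V : Type} [DecidableEq V]
    (G : SimpleGraph V) (E' : Finset (Sym2 V)) (hE' : ↑E' ⊆ G.edgeSet)
    (f : MvPolynomial (↥G.edgeSet × Bool) k) :
    f ∈ cutIdealOn k G E' hE' ↔ ∀ m ∈ f.support, ∃ A : Finset V,
      ∀ e (he : e ∈ E'), m (⟨e, hE' he⟩, crossBool A e) ≠ 0 := by
  classical
  let d : Finset V → (↥G.edgeSet × Bool) →₀ ℕ := fun A =>
    ∑ e ∈ E'.attach, Finsupp.single (⟨⟨e.1, hE' e.2⟩, crossBool A e.1⟩ : ↥G.edgeSet × Bool) 1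
  have hgen : ∀ A, cutGen k G E' hE' A = monomial (d A) 1 := by
    intro A
    simp only [cutGen, d, monomial_sum_one]
    rfl
  have hspan : cutIdealOn k G E' hE' =
      Ideal.span (Set.image (fun s => monomial s (1 : k)) (Set.range d)) := by
    rw [cutIdealOn, ← Set.range_comp]
    congr 2
    funext A
    exact hgen A
  rw [hspan, mem_ideal_span_monomial_image]
  refine forall₂_congr fun m _ => ?_
  rw [Set.exists_range_iff]
  refine exists_congr fun A => ?_
  have hd : ∀ x : ↥G.edgeSet × Bool, d A x =
      if x.1.1 ∈ E' ∧ x.2 = crossBool A x.1.1 then 1 else 0 := by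
    rintro ⟨⟨e, he⟩, b⟩
    simp only [d, Finsupp.finsetSum_apply, Finsupp.single_apply, Prod.mk.injEq, Subtype.mk.injEq]
    split_ifs with h
    · rw [Finset.sum_eq_single ⟨e, h.1⟩]
      · simp [h.2]
      · rintro ⟨e', he'⟩ _ hne
        rw [if_neg]
        rintro ⟨rfl, _⟩
        exact hne rfl
      · simp
    · apply Finset.sum_eq_zero
      rintro ⟨e', he'⟩ _
      rw [if_neg]
      rintro ⟨rfl, rfl⟩
      exact h ⟨he', rfl⟩
  constructor
  · intro h e he h0
    have := h (⟨e, hE' he⟩, crossBool A e)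
    rw [hd, h0] at this
    simp [he] at this
  · rintro h ⟨⟨e, he⟩, b⟩
    rw [hd]
    split_ifs with hc
    · obtain ⟨h1, h2⟩ := hc
      simp only at h1 h2
      subst h2
      have := h e h1
      exact Nat.one_le_iff_ne_zero.2 this
    · exact Nat.zero_le _

/-- If `G` is a finite simple connected graph which is not a cycle and has at least two
edges, then `I(G)` is the intersection of the ideals `I(H)` over all proper connected
subgraphs `H` of `G`. -/
theorem monomial_cut_ideal_eq_iInf_proper_subgraphs
    (k : Type) [Field k] {V : Type} [Fintype V] [DecidableEq V]
    (G : SimpleGraph V) [DecidableRel G.Adj] (hG : G.Connected)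
    (hnotcycle : ¬ ∃ n : ℕ, 3 ≤ n ∧ Nonempty (G ≃g SimpleGraph.cycleGraph n))
    (hedges : 2 ≤ Fintype.card ↥G.edgeSet) :
    cutIdeal k G =
      ⨅ H ∈ {H : G.Subgraph | H ≠ ⊤ ∧ H.Connected}, subgraphCutIdeal k G H := by
  ext f
  simp only [Submodule.mem_iInf, Set.mem_ofPred_eq]
  constructor
  · intro hf H _
    rw [subgraphCutIdeal, mem_cutIdealOn]
    rw [cutIdeal, mem_cutIdealOn] at hf
    intro m hm
    obtain ⟨A, hA⟩ := hf m hm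
    refine ⟨A, fun e he => hA e ?_⟩
    rw [Set.Finite.mem_toFinset] at he
    rw [Set.mem_toFinset]
    exact H.edgeSet_subset he
  · intro hf
    rw [cutIdeal, mem_cutIdealOn]
    intro m hm
    let P : Sym2 V → Bool → Prop := fun e b => ∃ h : e ∈ G.edgeSet, m (⟨e, h⟩, b) ≠ 0
    have hH : ∀ H : G.Subgraph, H ≠ ⊤ → H.Connected →
        ∃ A : Finset V, ∀ e ∈ H.edgeSet, P e (crossBool A e) := by
      intro H h1 h2
      have := hf H ⟨h1, h2⟩
      rw [subgraphCutIdeal, mem_cutIdealOn] at this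
      obtain ⟨A, hA⟩ := this m hm
      exact ⟨A, fun e he => ⟨H.edgeSet_subset he, hA e (by rwa [Set.Finite.mem_toFinset])⟩⟩
    have hne : ∀ e ∈ G.edgeSet, ∃ b, P e b := by
      intro e he
      induction e using Sym2.ind with
      | _ u v =>
      have huv : G.Adj u v := he
      obtain ⟨A, hA⟩ := hH (G.subgraphOfAdj huv) (by
        intro htop
        have h1 : ∀ x y : ↥G.edgeSet, x = y := by
          have : ∀ x ∈ G.edgeSet, x = s(u, v) := by
            intro x hx
            have : x ∈ (G.subgraphOfAdj huv).edgeSet := by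
              rw [htop, SimpleGraph.Subgraph.edgeSet_top]; exact hx
            simpa using this
          rintro ⟨x, hx⟩ ⟨y, hy⟩
          exact Subtype.ext ((this x hx).trans (this y hy).symm)
        have := Fintype.card_le_one_iff.2 h1
        omega) (SimpleGraph.Subgraph.subgraphOfAdj_connected huv)
      exact ⟨_, hA s(u, v) (by simp)⟩
    obtain ⟨A, hA⟩ := comb_core G hnotcycle P hne hH
    refine ⟨A, fun e he => ?_⟩
    rw [Set.mem_toFinset] at he
    obtain ⟨_, h⟩ := hA e he
    exact h
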